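/- For an irrational number x₀ ∈ (0,1), for all n ≥ 1 the approximation coefficients satisfy min{θₙ₋₁, θₙ} < 1/2 (Vahlen's theorem). -/

import Mathlib

noncomputable section

open Real

/-- The Gauss map `T x = 1/x - ⌊1/x⌋`. -/
def gauss (x : ℝ) : ℝ := 1 / x - ⌊1 / x⌋

/-- The future of `x₀` at time `n`: `xₙ = Tⁿ x₀`. -/
def fut (x₀ : ℝ) (n : ℕ) : ℝ := gauss^[n] x₀

/-- The `n`-th partial quotient (digit) of `x₀` (meaningful for `n ≥ 1`):
`aₙ = ⌊1/xₙ₋₁⌋`. -/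
def digit (x₀ : ℝ) (n : ℕ) : ℤ := ⌊1 / fut x₀ (n - 1)⌋

/-- Numerators of the continued fraction convergents of `x₀ ∈ (0,1)`. -/
def num (x₀ : ℝ) : ℕ → ℤ
  | 0 => 0
  | 1 => 1
  | (n + 2) => digit x₀ (n + 2) * num x₀ (n + 1) + num x₀ n

/-- Denominators of the continued fraction convergents of `x₀ ∈ (0,1)`. -/
def den (x₀ : ℝ) : ℕ → ℤ
  | 0 => 1
  | 1 => digit x₀ 1
  | (n + 2) => digit x₀ (n + 2) * den x₀ (n + 1) + den x₀ n

/-- The `n`-th approximation coefficient `θₙ = qₙ² |x₀ - pₙ/qₙ|`. -/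
def theta (x₀ : ℝ) (n : ℕ) : ℝ :=
  (den x₀ n : ℝ) ^ 2 * |x₀ - (num x₀ n : ℝ) / (den x₀ n : ℝ)|

/-- Finite continued fraction `[b₁,...,bₖ] = 1/(b₁ + 1/(⋯ + 1/bₖ))`, with `[∅] = 0`. -/
def fcf : List ℝ → ℝ
  | [] => 0
  | (b :: bs) => 1 / (b + fcf bs)

/-- The past of `x₀` at time `n ≥ 1`: `yₙ = -aₙ - [aₙ₋₁, aₙ₋₂, ..., a₁]`. -/
def past (x₀ : ℝ) (n : ℕ) : ℝ :=
  -(digit x₀ n : ℝ) -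
    fcf (((List.range (n - 1)).map fun i => ((digit x₀ (n - 1 - i) : ℤ) : ℝ)))

/-- The domain `Ω = (0,1) × (-∞,-1)`. -/
def Omega : Set (ℝ × ℝ) := Set.Ioo (0 : ℝ) 1 ×ˢ Set.Iio (-1 : ℝ)

/-- The open triangle `Γ` with vertices `(0,0)`, `(1,0)`, `(0,1)`. -/
def Gam : Set (ℝ × ℝ) := {p | 0 < p.1 ∧ 0 < p.2 ∧ p.1 + p.2 < 1}

/-- The map `Ψ(x,y) = (1/(x-y), -xy/(x-y))`. -/
def Psi (p : ℝ × ℝ) : ℝ × ℝ := (1 / (p.1 - p.2), -(p.1 * p.2) / (p.1 - p.2))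

/-- The map `Φ(u,v) = ((1-√(1-4uv))/(2u), -(1+√(1-4uv))/(2u))`. -/
def Phi (p : ℝ × ℝ) : ℝ × ℝ :=
  ((1 - Real.sqrt (1 - 4 * p.1 * p.2)) / (2 * p.1),
   -((1 + Real.sqrt (1 - 4 * p.1 * p.2)) / (2 * p.1)))

/-- The natural extension map `𝒯(x,y) = (1/x - ⌊1/x⌋, 1/y - ⌊1/x⌋)`. -/
def natExt (p : ℝ × ℝ) : ℝ × ℝ := (1 / p.1 - ⌊1 / p.1⌋, 1 / p.2 - ⌊1 / p.1⌋)

theorem irrational_gauss {x : ℝ} (h : Irrational x) : Irrational (gauss x) := by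
  simpa [gauss] using h.inv.sub_intCast ⌊x⁻¹⌋

theorem gauss_mem_Ioo {x : ℝ} (h : Irrational x) : gauss x ∈ Set.Ioo (0 : ℝ) 1 :=
  ⟨lt_of_le_of_ne (Int.fract_nonneg (1 / x)) (irrational_gauss h).ne_zero.symm,
    Int.fract_lt_one (1 / x)⟩

theorem irrational_fut {x₀ : ℝ} (h : Irrational x₀) (n : ℕ) : Irrational (fut x₀ n) := by
  induction n with
  | zero => exact h
  | succ n ih =>
    rw [fut, Function.iterate_succ_apply']
    exact irrational_gauss ih

theorem fut_succ (x₀ : ℝ) (n : ℕ) : fut x₀ (n + 1) = 1 / fut x₀ n - digit x₀ (n + 1) := by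
  rw [fut, Function.iterate_succ_apply']
  rfl

theorem fut_mem_Ioo {x₀ : ℝ} (hx : x₀ ∈ Set.Ioo (0 : ℝ) 1) (h : Irrational x₀) (n : ℕ) :
    fut x₀ n ∈ Set.Ioo (0 : ℝ) 1 := by
  cases n with
  | zero => exact hx
  | succ n =>
    rw [fut, Function.iterate_succ_apply']
    exact gauss_mem_Ioo (irrational_fut h n)

theorem one_le_digit_succ {x₀ : ℝ} (hx : x₀ ∈ Set.Ioo (0 : ℝ) 1) (h : Irrational x₀) (n : ℕ) :
    1 ≤ digit x₀ (n + 1) := by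
  obtain ⟨h0, h1⟩ := fut_mem_Ioo hx h n
  rw [digit, Nat.add_sub_cancel, Int.le_floor, Int.cast_one, le_div_iff₀ h0]
  linarith

theorem den_pos_and_le_succ {x₀ : ℝ} (hx : x₀ ∈ Set.Ioo (0 : ℝ) 1) (h : Irrational x₀) (n : ℕ) :
    0 < den x₀ n ∧ den x₀ n ≤ den x₀ (n + 1) := by
  induction n with
  | zero => exact ⟨one_pos, one_le_digit_succ hx h 0⟩
  | succ n ih =>
    obtain ⟨h0, h1⟩ := ih
    have ha := one_le_digit_succ hx h (n + 1)
    refine ⟨by lia, ?_⟩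
    rw [den]
    nlinarith

theorem num_den_determinant (x₀ : ℝ) (n : ℕ) :
    num x₀ (n + 1) * den x₀ n - num x₀ n * den x₀ (n + 1) = (-1) ^ n := by
  induction n with
  | zero => simp [num, den]
  | succ n ih =>
    rw [num, den, pow_succ, ← ih]
    ring

theorem mul_den_add_fut {x₀ : ℝ} (hx : x₀ ∈ Set.Ioo (0 : ℝ) 1) (h : Irrational x₀) (n : ℕ) :
    x₀ * (den x₀ (n + 1) + den x₀ n * fut x₀ (n + 1)) =
      num x₀ (n + 1) + num x₀ n * fut x₀ (n + 1) := by
  induction n with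
  | zero =>
    have h0 : x₀ ≠ 0 := hx.1.ne'
    rw [fut_succ]
    simp [num, den, fut, h0]
  | succ n ih =>
    have h0 : fut x₀ (n + 1) ≠ 0 := (fut_mem_Ioo hx h (n + 1)).1.ne'
    rw [fut_succ, num, den]
    push_cast
    field_simp
    linear_combination ih

theorem theta_eq {x₀ : ℝ} (hx : x₀ ∈ Set.Ioo (0 : ℝ) 1) (h : Irrational x₀) (n : ℕ) :
    theta x₀ n = den x₀ n / (den x₀ (n + 1) + den x₀ n * fut x₀ (n + 1)) ∧
      theta x₀ (n + 1) =
        den x₀ (n + 1) * fut x₀ (n + 1) / (den x₀ (n + 1) + den x₀ n * fut x₀ (n + 1)) := by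
  have hq : (0 : ℝ) < den x₀ n := by exact_mod_cast (den_pos_and_le_succ hx h n).1
  have hq' : (0 : ℝ) < den x₀ (n + 1) := by exact_mod_cast (den_pos_and_le_succ hx h (n + 1)).1
  have ht := (fut_mem_Ioo hx h (n + 1)).1
  have hdet : (num x₀ (n + 1) * den x₀ n - num x₀ n * den x₀ (n + 1) : ℝ) = (-1) ^ n := by
    exact_mod_cast num_den_determinant x₀ n
  have hrec := mul_den_add_fut hx h n
  rw [theta, theta]
  generalize (den x₀ n : ℝ) = q at *
  generalize (den x₀ (n + 1) : ℝ) = q' at *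
  generalize fut x₀ (n + 1) = t at *
  have hD : 0 < q' + q * t := by positivity
  have e1 : x₀ - num x₀ n / q = (-1) ^ n / (q * (q' + q * t)) := by
    rw [← hdet]
    field_simp
    linear_combination q * hrec
  have e2 : x₀ - num x₀ (n + 1) / q' = -((-1) ^ n * t / (q' * (q' + q * t))) := by
    rw [← hdet]
    field_simp
    linear_combination q' * hrec
  rw [e1, e2, abs_neg, abs_div, abs_div, abs_mul ((-1) ^ n), abs_pow, abs_neg, abs_one, one_pow,
    abs_of_pos ht, abs_of_pos (by positivity : 0 < q * (q' + q * t)),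
    abs_of_pos (by positivity : 0 < q' * (q' + q * t))]
  constructor <;> field_simp

theorem stmt1 (x₀ : ℝ) (hx : x₀ ∈ Set.Ioo (0:ℝ) 1) (hirr : Irrational x₀)
    (n : ℕ) (hn : 1 ≤ n) : min (theta x₀ (n - 1)) (theta x₀ n) < 1 / 2 := by
  obtain ⟨m, rfl⟩ := Nat.exists_eq_add_of_le' hn
  rw [Nat.add_sub_cancel]
  obtain ⟨e1, e2⟩ := theta_eq hx hirr m
  have hq : (0 : ℝ) < den x₀ m := by exact_mod_cast (den_pos_and_le_succ hx hirr m).1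
  have hle : (den x₀ m : ℝ) ≤ den x₀ (m + 1) := by
    exact_mod_cast (den_pos_and_le_succ hx hirr m).2
  obtain ⟨ht0, ht1⟩ := fut_mem_Ioo hx hirr (m + 1)
  have hD : (0 : ℝ) < den x₀ (m + 1) + den x₀ m * fut x₀ (m + 1) :=
    add_pos (hq.trans_le hle) (mul_pos hq ht0)
  by_contra! hcon
  obtain ⟨h1, h2⟩ := le_min_iff.mp hcon
  rw [e1, le_div_iff₀ hD] at h1
  rw [e2, le_div_iff₀ hD] at h2
  have heq : (den x₀ (m + 1) : ℝ) = den x₀ m := by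
    refine le_antisymm ?_ hle
    by_contra! hlt
    nlinarith [mul_pos (sub_pos.mpr hlt) (sub_pos.mpr ht1)]
  rw [heq] at h2
  nlinarith [mul_pos hq (sub_pos.mpr ht1)]
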